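/- arXiv:0903.4872 — 3 statements merged into one kernel-verified Lean document; each statement's English description precedes it below -/
import Mathlib

section
/- Let A be a nonempty set and let f, g be transformations of A. Then pr₂ f ⊆ pr₁ g if and only if pr₁ f ⊆ pr₁ (g∘f). (In other words, (f,g) belongs to the semiadjacency relation δ_Φ if and only if (f, g∘f) belongs to the projection quasi-order χ_Φ.) -/
/-- A transformation (partial map) of `A`, viewed as a binary relation. -/
def IsTransformation {A : Type*} (f : Set (A × A)) : Prop :=
  ∀ ⦃a b c : A⦄, (a, b) ∈ f → (a, c) ∈ f → b = c

/-- Composition of binary relations: `comp g f = g ∘ f`. -/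
def comp {A : Type*} (g f : Set (A × A)) : Set (A × A) :=
  {p | ∃ b, (p.1, b) ∈ f ∧ (b, p.2) ∈ g}

/-- The domain of a binary relation. -/
def pr1 {A : Type*} (f : Set (A × A)) : Set A := {a | ∃ b, (a, b) ∈ f}

/-- The image of a binary relation. -/
def pr2 {A : Type*} (f : Set (A × A)) : Set A := {b | ∃ a, (a, b) ∈ f}

/-- (f,g) ∈ δ_Φ ↔ (f, g∘f) ∈ χ_Φ for transformations f, g of a nonempty set A. -/
theorem statement_0 {A : Type*} [Nonempty A] (f g : Set (A × A))
    (hf : IsTransformation f) (hg : IsTransformation g) :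
    pr2 f ⊆ pr1 g ↔ pr1 f ⊆ pr1 (comp g f) := by
  constructor
  · rintro h a ⟨b, hab⟩
    obtain ⟨c, hbc⟩ := h ⟨a, hab⟩
    exact ⟨c, b, hab, hbc⟩
  · rintro h b ⟨a, hab⟩
    obtain ⟨c, b', hab', hbc⟩ := h ⟨b, hab⟩
    obtain rfl := hf hab hab'
    exact ⟨c, hbc⟩
end

section
/- An algebra (G,·,⋏) is isomorphic to some ∩-semigroup of transformations if and only if (G,·) is a semigroup, (G,⋏) is a semilattice, and the identities x(y⋏z) = xy⋏xz and (x⋏y⋏z)u ⋏ (y⋏z)v = (x⋏y)u ⋏ (y⋏z)v hold for all x,y,z ∈ G and all u,v ∈ G, where the second identity must also hold with either or both of the factors u, v omitted (equivalently, for u,v ranging over G¹). -/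
universe u

/-- `act mul g x` is the product `g·x` where `x` ranges over `G¹ = G ∪ {e}`
(`none` playing the role of the adjoined identity `e`, i.e. the omitted factor). -/
def act {G : Type u} (mul : G → G → G) (g : G) : Option G → G
  | none => g
  | some h => mul g h

/-- A semigroup with a compatible meet operation satisfying the identities of an abstract
`∩`-semigroup of transformations. -/
class TransformationInfSemigroup (G : Type u) extends Semigroup G, SemilatticeInf G where
  mul_inf (x y z : G) : x * (y ⊓ z) = (x * y) ⊓ (x * z)
  act_inf_inf_act (x y z : G) (u v : Option G) :
    act (· * ·) (x ⊓ y ⊓ z) u ⊓ act (· * ·) (y ⊓ z) v =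
      act (· * ·) (x ⊓ y) u ⊓ act (· * ·) (y ⊓ z) v

namespace TransformationInfSemigroup

variable {G : Type u} [TransformationInfSemigroup G]

/-- The product `x·u` with an optional right factor. -/
abbrev rmul (x : G) (u : Option G) : G := act (· * ·) x u

/-- The product `x·g` with an optional left factor. -/
def lmul : Option G → G → G
  | none, g => g
  | some x, g => x * g

theorem rmul_act (x g : G) (w : Option G) : rmul x (some (rmul g w)) = rmul (x * g) w := by
  cases w <;> simp [rmul, act, mul_assoc]

theorem lmul_mul (x : Option G) (g h : G) : lmul x (g * h) = lmul x g * h := by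
  cases x <;> simp [lmul, mul_assoc]

theorem lmul_inf (x : Option G) (g h : G) : lmul x (g ⊓ h) = lmul x g ⊓ lmul x h := by
  cases x <;> simp [lmul, mul_inf]

theorem rmul_inf_rmul {x y : G} (h : y ≤ x) (u v : Option G) :
    rmul y u ⊓ rmul y v = rmul x u ⊓ rmul y v := by
  have := act_inf_inf_act x x y u v
  simpa [inf_eq_right.2 h] using this

theorem rmul_mono {x y : G} (h : y ≤ x) (u : Option G) : rmul y u ≤ rmul x u := by
  have := rmul_inf_rmul h u u
  rw [inf_idem] at this
  exact this.le.trans inf_le_left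

/-- `Agree a x y` says that `x` and `y` must take a common value at any point of the domain
of `a`. -/
def Agree (a x y : G) : Prop := ∃ u, a ≤ rmul (x ⊓ y) u

theorem Agree.symm {a x y : G} (h : Agree a x y) : Agree a y x := by
  simpa [Agree, inf_comm] using h

theorem Agree.trans {a x y z : G} (h : Agree a x y) (k : Agree a y z) : Agree a x z := by
  obtain ⟨u, hu⟩ := h
  obtain ⟨v, hv⟩ := k
  have h₂ := le_inf hu hv
  rw [← act_inf_inf_act] at h₂
  exact ⟨u, (h₂.trans inf_le_left).trans
    (rmul_mono (le_inf (inf_le_left.trans inf_le_left) inf_le_right) u)⟩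

theorem Agree.left {a x y : G} (h : Agree a x y) : Agree a x x := h.trans h.symm

theorem Agree.right {a x y : G} (h : Agree a x y) : Agree a y y := h.symm.trans h

theorem Agree.of_mul {a x g : G} (h : Agree a (x * g) (x * g)) : Agree a x x := by
  obtain ⟨w, hw⟩ := h
  rw [inf_idem, ← rmul_act] at hw
  exact ⟨_, by rwa [inf_idem]⟩

theorem Agree.le_inf {a x y : G} (h : Agree a x y) {v : Option G} (hv : a ≤ rmul x v) :
    a ≤ rmul (x ⊓ y) v := by
  obtain ⟨u, hu⟩ := h
  have h₂ := _root_.le_inf hv hu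
  rw [← rmul_inf_rmul inf_le_left] at h₂
  exact h₂.trans inf_le_left

theorem Agree.mul_right {a x y g : G} (h : Agree a x y) (k : Agree a (x * g) (x * g)) :
    Agree a (x * g) (y * g) := by
  obtain ⟨w, hw⟩ := k
  rw [inf_idem, ← rmul_act] at hw
  have h₂ := h.le_inf hw
  rw [rmul_act] at h₂
  exact ⟨w, h₂.trans (rmul_mono (_root_.le_inf (rmul_mono inf_le_left (some g))
    (rmul_mono inf_le_right (some g))) w)⟩

/-- The point of the representation over `a` which is the value of `x` at the base point;
the omitted element gives the base point itself. -/
def point (a : G) (x : Option G) : Option G × Option (Set G) :=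
  (some a, x.map fun y => {z | Agree a y z})

theorem Agree.point_eq {a x y : G} (h : Agree a x y) :
    point a (some x) = point a (some y) := by
  have : {z | Agree a x z} = {z | Agree a y z} :=
    Set.ext fun z => ⟨h.symm.trans, h.trans⟩
  simp [point, this]

theorem agree_of_point_eq {a b x y : G} (h : point a (some x) = point b (some y))
    (hy : Agree b y y) : a = b ∧ Agree b x y := by
  simp only [point, Prod.mk.injEq, Option.some.injEq, Option.map_some] at h
  obtain ⟨rfl, h⟩ := h
  exact ⟨rfl, (Set.ext_iff.1 h y).2 hy⟩

theorem agree_lmul {a b : G} {x y : Option G} (h : point a x = point b y) {g : G}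
    (hg : Agree b (lmul y g) (lmul y g)) : a = b ∧ Agree b (lmul x g) (lmul y g) := by
  rcases x with _ | x <;> rcases y with _ | y
  · simp only [point, Prod.mk.injEq, Option.some.injEq] at h
    exact ⟨h.1, hg⟩
  · simp [point] at h
  · simp [point] at h
  · obtain ⟨h₁, h₂⟩ := agree_of_point_eq h hg.of_mul
    exact ⟨h₁, (h₂.symm.mul_right hg).symm⟩

/-- The partial map representing `g`. -/
def repr (g : G) : Set ((Option G × Option (Set G)) × (Option G × Option (Set G))) :=
  {p | ∃ (a : G) (x : Option G), Agree a (lmul x g) (lmul x g) ∧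
    p = (point a x, point a (some (lmul x g)))}

theorem isTransformation_repr (g : G) : IsTransformation (repr g) := by
  rintro p q r ⟨a, x, h, e⟩ ⟨b, y, k, f⟩
  simp only [Prod.mk.injEq] at e f
  obtain ⟨rfl, hxy⟩ := agree_lmul (e.1.symm.trans f.1) k
  rw [e.2, f.2, hxy.point_eq]

theorem repr_mul (g h : G) : repr (g * h) = comp (repr h) (repr g) := by
  ext ⟨p, q⟩
  constructor
  · rintro ⟨a, x, hx, e⟩
    simp only [Prod.mk.injEq, lmul_mul] at e hx
    obtain ⟨rfl, rfl⟩ := e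
    exact ⟨point a (some (lmul x g)), ⟨a, x, hx.of_mul, rfl⟩, ⟨a, some (lmul x g), hx, rfl⟩⟩
  · rintro ⟨r, ⟨a, x, hx, e⟩, ⟨b, y, hy, f⟩⟩
    simp only [Prod.mk.injEq] at e f
    obtain ⟨rfl, hxy⟩ := agree_lmul (e.2.symm.trans f.1) hy
    refine ⟨a, x, ?_, ?_⟩
    · rw [lmul_mul]
      exact hxy.left
    · rw [e.1, f.2, lmul_mul, ← hxy.point_eq]
      rfl

theorem repr_inf (g h : G) : repr (g ⊓ h) = repr g ∩ repr h := by
  ext ⟨p, q⟩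
  constructor
  · rintro ⟨a, x, ⟨u, hu⟩, e⟩
    rw [lmul_inf] at hu e
    rw [inf_idem] at hu
    simp only [Prod.mk.injEq] at e
    obtain ⟨rfl, rfl⟩ := e
    have h₁ : Agree a (lmul x g ⊓ lmul x h) (lmul x g) := ⟨u, by simpa [inf_right_comm] using hu⟩
    have h₂ : Agree a (lmul x g ⊓ lmul x h) (lmul x h) := ⟨u, by simpa [inf_assoc] using hu⟩
    exact ⟨⟨a, x, h₁.right, by rw [h₁.point_eq]⟩, ⟨a, x, h₂.right, by rw [h₂.point_eq]⟩⟩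
  · rintro ⟨⟨a, x, hx, e⟩, ⟨b, y, hy, f⟩⟩
    simp only [Prod.mk.injEq] at e f
    obtain ⟨rfl, hxy⟩ := agree_lmul (e.1.symm.trans f.1) hy
    obtain ⟨-, k⟩ := agree_of_point_eq (e.2.symm.trans f.2) hy
    obtain ⟨u, hu⟩ := k.trans hxy.symm
    refine ⟨a, x, ⟨u, by rwa [inf_idem, lmul_inf]⟩, ?_⟩
    have h₁ : Agree a (lmul x g ⊓ lmul x h) (lmul x g) := ⟨u, by simpa [inf_right_comm] using hu⟩
    rw [e.1, e.2, lmul_inf, h₁.point_eq]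

theorem le_of_repr_subset {g h : G} (H : repr g ⊆ repr h) : g ≤ h := by
  have hg : Agree g g g := ⟨none, by simp [rmul, act]⟩
  obtain ⟨b, y, hy, f⟩ := H ⟨g, none, hg, rfl⟩
  simp only [Prod.mk.injEq] at f
  obtain ⟨rfl, hxy⟩ := agree_lmul f.1 hy
  obtain ⟨-, k⟩ := agree_of_point_eq f.2 hy
  have h₂ := (k.trans hxy.symm).le_inf (v := none) le_rfl
  exact h₂.trans inf_le_right

theorem repr_injective : Function.Injective (repr (G := G)) := fun _ _ h =>
  le_antisymm (le_of_repr_subset h.subset) (le_of_repr_subset h.superset)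

end TransformationInfSemigroup

theorem comp_assoc {A : Type*} (f g h : Set (A × A)) : comp h (comp g f) = comp (comp h g) f := by
  ext ⟨p, q⟩
  constructor
  · rintro ⟨r, ⟨s, hs, hr⟩, hq⟩
    exact ⟨s, hs, r, hr, hq⟩
  · rintro ⟨s, hs, r, hr, hq⟩
    exact ⟨r, ⟨s, hs, hr⟩, hq⟩

theorem IsTransformation.comp_inter {A : Type*} {f : Set (A × A)} (hf : IsTransformation f)
    (g h : Set (A × A)) : comp (g ∩ h) f = comp g f ∩ comp h f := by
  ext ⟨p, q⟩
  constructor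
  · rintro ⟨r, hr, hg, hh⟩
    exact ⟨⟨r, hr, hg⟩, ⟨r, hr, hh⟩⟩
  · rintro ⟨⟨r, hr, hg⟩, ⟨s, hs, hh⟩⟩
    obtain rfl := hf hr hs
    exact ⟨r, hr, hg, hh⟩

/-- Membership in the image of a product with an optional right factor. -/
theorem mem_image_act {G A : Type*} {mul : G → G → G} {P : G → Set (A × A)}
    (hmul : ∀ a b, P (mul a b) = comp (P b) (P a)) (g : G) (u : Option G) (p q : A) :
    (p, q) ∈ P (act mul g u) ↔
      ∃ b, (p, b) ∈ P g ∧ u.elim (b = q) fun h => (b, q) ∈ P h := by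
  cases u with
  | none => simp [act]
  | some h => simp [act, hmul, comp]

/-- Garvatskii's theorem: an algebra (G,·,⋏) is isomorphic to some ∩-semigroup of
transformations iff (G,·) is a semigroup, (G,⋏) is a semilattice, x(y⋏z)=xy⋏xz and
(x⋏y⋏z)u ⋏ (y⋏z)v = (x⋏y)u ⋏ (y⋏z)v for all x,y,z ∈ G and u,v ∈ G¹ (i.e. with
either or both of the factors u, v possibly omitted). -/
theorem statement_2 {G : Type u} (mul meet : G → G → G) :
    (∃ (A : Type u) (_ : Nonempty A) (Φ : Set (Set (A × A))),
      (∀ f ∈ Φ, IsTransformation f) ∧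
      (∀ f ∈ Φ, ∀ g ∈ Φ, comp g f ∈ Φ) ∧
      (∀ f ∈ Φ, ∀ g ∈ Φ, f ∩ g ∈ Φ) ∧
      ∃ P : G → Set (A × A),
        (∀ g, P g ∈ Φ) ∧ Function.Injective P ∧ (∀ f ∈ Φ, ∃ g, P g = f) ∧
        (∀ a b, P (mul a b) = comp (P b) (P a)) ∧
        (∀ a b, P (meet a b) = P a ∩ P b)) ↔
    ((∀ a b c, mul (mul a b) c = mul a (mul b c)) ∧
     (∀ a b, meet a b = meet b a) ∧
     (∀ a b c, meet (meet a b) c = meet a (meet b c)) ∧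
     (∀ a, meet a a = a) ∧
     (∀ x y z, mul x (meet y z) = meet (mul x y) (mul x z)) ∧
     (∀ (x y z : G) (u v : Option G),
       meet (act mul (meet (meet x y) z) u) (act mul (meet y z) v) =
         meet (act mul (meet x y) u) (act mul (meet y z) v))) := by
  constructor
  · rintro ⟨A, -, Φ, hT, -, -, P, hP, hinj, -, hmul, hmeet⟩
    have hTP (g : G) : IsTransformation (P g) := hT _ (hP g)
    refine ⟨fun a b c => hinj ?_, fun a b => hinj ?_, fun a b c => hinj ?_, fun a => hinj ?_,
      fun x y z => hinj ?_, fun x y z u v => hinj ?_⟩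
    · simp only [hmul, comp_assoc]
    · simp only [hmeet, Set.inter_comm]
    · simp only [hmeet, Set.inter_assoc]
    · simp only [hmeet, Set.inter_self]
    · simp only [hmeet, hmul, (hTP x).comp_inter]
    · ext ⟨p, q⟩
      simp only [hmeet, Set.mem_inter_iff, mem_image_act hmul]
      constructor
      · rintro ⟨⟨b, ⟨hxy, -⟩, hu⟩, hv⟩
        exact ⟨⟨b, hxy, hu⟩, hv⟩
      · rintro ⟨⟨b, hxy, hu⟩, c, hyz, hv⟩
        obtain rfl := hTP y hxy.2 hyz.1
        exact ⟨⟨b, ⟨hxy, hyz.2⟩, hu⟩, b, hyz, hv⟩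
  · rintro ⟨h_assoc, h_comm, h_inf_assoc, h_idem, h_mul_inf, h_act⟩
    let _ : Mul G := ⟨mul⟩
    let _ : Min G := ⟨meet⟩
    let _ : TransformationInfSemigroup G :=
      { SemilatticeInf.mk' h_comm h_inf_assoc h_idem with
        mul_assoc := h_assoc
        mul_inf := h_mul_inf
        act_inf_inf_act := h_act }
    have hmul (a b : G) := TransformationInfSemigroup.repr_mul a b
    have hinf (a b : G) := TransformationInfSemigroup.repr_inf a b
    refine ⟨Option G × Option (Set G), inferInstance,
      Set.range (TransformationInfSemigroup.repr (G := G)), ?_, ?_, ?_,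
      TransformationInfSemigroup.repr, fun g => ⟨g, rfl⟩,
      TransformationInfSemigroup.repr_injective, fun f hf => hf, hmul, hinf⟩
    · rintro _ ⟨g, rfl⟩
      exact TransformationInfSemigroup.isTransformation_repr g
    · rintro _ ⟨g, rfl⟩ _ ⟨h, rfl⟩
      exact ⟨g * h, hmul g h⟩
    · rintro _ ⟨g, rfl⟩ _ ⟨h, rfl⟩
      exact ⟨g ⊓ h, hinf g h⟩
end

section
/- An algebraic system (G,·,⋏,χ), where (G,·) is a semigroup, (G,⋏) is a semilattice and χ is a binary relation on G (write x ⊏ y for (x,y) ∈ χ, and x ≤ y for x⋏y = x), is isomorphic to some projection ∩-semigroup (Φ,∘,∩,χ_Φ) of transformations if and only if: χ is a left regular and right negative quasi-order containing the semilattice order ≤; the identity x(y⋏z) = xy⋏xz holds; x ⊏ x⋏y implies x ≤ y; (x⋏y)u ≤ yu; and x ⊏ y⋏z together with x ⊏ (z⋏v)u implies x ⊏ (y⋏z⋏v)u — the last two conditions being required for all elements of G and also in the versions with the factor u omitted. -/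
universe u

/-- The abstract properties of a semigroup, a semilattice and a projection quasi-order on `G`. -/
structure IsProjectionSystem {G : Type u} (mul meet : G → G → G) (χ : G → G → Prop) : Prop where
  assoc : ∀ a b c, mul (mul a b) c = mul a (mul b c)
  comm : ∀ a b, meet a b = meet b a
  meet_assoc : ∀ a b c, meet (meet a b) c = meet a (meet b c)
  idem : ∀ a, meet a a = a
  refl : ∀ a, χ a a
  trans : ∀ a b c, χ a b → χ b c → χ a c
  left_regular : ∀ x a b, χ a b → χ (mul x a) (mul x b)
  right_negative : ∀ x y z, χ x (mul y z) → χ x y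
  of_le : ∀ a b, meet a b = a → χ a b
  mul_meet : ∀ x y z, mul x (meet y z) = meet (mul x y) (mul x z)
  le_of_meet : ∀ x y, χ x (meet x y) → meet x y = x
  act_le : ∀ (x y : G) (v : Option G), meet (act mul (meet x y) v) (act mul y v) =
    act mul (meet x y) v
  meet_act : ∀ (x y z v : G) (w : Option G), χ x (meet y z) → χ x (act mul (meet z v) w) →
    χ x (act mul (meet (meet y z) v) w)

/-- The product `x·a` where the left factor may be omitted. -/
def coact {G : Type u} (mul : G → G → G) : Option G → G → G
  | none, a => a
  | some x, a => mul x a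

/-- Two elements of `G` with an identity adjoined agree at `g` if `g ⊏ x ⋏ y`; the identity
agrees only with itself. -/
def AgreeAt {G : Type u} (meet : G → G → G) (χ : G → G → Prop) (g : G) :
    Option G → Option G → Prop
  | none, none => True
  | some x, some y => χ g (meet x y)
  | _, _ => False

/-- The class of elements agreeing with `x` at `g`. -/
def agreeClass {G : Type u} (meet : G → G → G) (χ : G → G → Prop) (g : G) (x : Option G) :
    Set (Option G) :=
  {y | AgreeAt meet χ g x y}

/-- The transformation representing `a`, acting on agreement classes by right multiplication
wherever the product dominates the base point. -/
def rightTranslation {G : Type u} (mul meet : G → G → G) (χ : G → G → Prop) (a : G) :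
    Set ((Option G × Set (Option G)) × (Option G × Set (Option G))) :=
  {p | ∃ g x, p.1 = (some g, agreeClass meet χ g x) ∧ χ g (coact mul x a) ∧
    p.2 = (some g, agreeClass meet χ g (some (coact mul x a)))}

namespace IsProjectionSystem

variable {G : Type u} {mul meet : G → G → G} {χ : G → G → Prop}

theorem meet_left (h : IsProjectionSystem mul meet χ) {g x y : G} (hg : χ g (meet x y)) :
    χ g x := by
  refine h.trans _ _ _ hg (h.of_le _ _ ?_)
  rw [h.comm, ← h.meet_assoc, h.idem]

theorem meet_right (h : IsProjectionSystem mul meet χ) {g x y : G} (hg : χ g (meet x y)) :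
    χ g y :=
  h.meet_left (h.comm x y ▸ hg)

theorem agreeAt_symm (h : IsProjectionSystem mul meet χ) {g : G} {x y : Option G}
    (hxy : AgreeAt meet χ g x y) : AgreeAt meet χ g y x := by
  cases x <;> cases y <;> simp_all [AgreeAt]
  rwa [h.comm]

theorem agreeAt_trans (h : IsProjectionSystem mul meet χ) {g : G} {x y z : Option G}
    (hxy : AgreeAt meet χ g x y) (hyz : AgreeAt meet χ g y z) : AgreeAt meet χ g x z := by
  rcases x with _ | x <;> rcases y with _ | y <;> rcases z with _ | z <;>
    simp_all only [AgreeAt]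
  have hm : χ g (meet (meet x y) z) := h.meet_act g x y z none hxy hyz
  rw [h.comm x y, h.meet_assoc] at hm
  exact h.meet_right hm

theorem agreeAt_self_of_coact (h : IsProjectionSystem mul meet χ) {g a : G} {x : Option G}
    (hx : χ g (coact mul x a)) : AgreeAt meet χ g x x := by
  rcases x with _ | x
  · trivial
  · simpa only [AgreeAt, h.idem] using h.right_negative _ _ _ hx

theorem agreeClass_eq_iff (h : IsProjectionSystem mul meet χ) {g : G} {x y : Option G}
    (hx : AgreeAt meet χ g x x) :
    agreeClass meet χ g x = agreeClass meet χ g y ↔ AgreeAt meet χ g x y := by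
  constructor
  · intro e
    have hm : x ∈ agreeClass meet χ g y := e ▸ hx
    exact h.agreeAt_symm hm
  · intro hxy
    ext z
    exact ⟨fun hz => h.agreeAt_trans (h.agreeAt_symm hxy) hz, fun hz => h.agreeAt_trans hxy hz⟩

theorem agreeAt_coact (h : IsProjectionSystem mul meet χ) {g a : G} {x y : Option G}
    (hxy : AgreeAt meet χ g x y) (hx : χ g (coact mul x a)) :
    χ g (meet (coact mul x a) (coact mul y a)) := by
  rcases x with _ | x <;> rcases y with _ | y <;> simp_all only [AgreeAt, coact]
  · rwa [h.idem]
  · have hm : χ g (mul (meet (meet y x) x) a) :=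
      h.meet_act g y x x (some a) (h.comm x y ▸ hxy) (by simpa only [act, h.idem] using hx)
    rw [h.meet_assoc, h.idem] at hm
    refine h.trans _ _ _ hm (h.of_le _ _ ?_)
    have h₁ : meet (mul (meet y x) a) (mul x a) = mul (meet y x) a := h.act_le y x (some a)
    have h₂ : meet (mul (meet x y) a) (mul y a) = mul (meet x y) a := h.act_le x y (some a)
    rw [h.comm x y] at h₂
    rw [← h.meet_assoc, h₁, h₂]

theorem mem_rightTranslation (h : IsProjectionSystem mul meet χ) {a g : G} {x : Option G}
    {q : Option G × Set (Option G)} :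
    ((some g, agreeClass meet χ g x), q) ∈ rightTranslation mul meet χ a ↔
      χ g (coact mul x a) ∧ q = (some g, agreeClass meet χ g (some (coact mul x a))) := by
  constructor
  · rintro ⟨g', x', e, hx', rfl⟩
    obtain ⟨rfl, e⟩ : g = g' ∧ agreeClass meet χ g x = agreeClass meet χ g' x' := by
      simpa using e
    have hm := h.agreeAt_coact
      ((h.agreeClass_eq_iff (h.agreeAt_self_of_coact hx')).1 e.symm) hx'
    refine ⟨h.meet_right hm, Prod.ext rfl ?_⟩
    exact (h.agreeClass_eq_iff (by simpa only [AgreeAt, h.idem] using hx')).2 hm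
  · rintro ⟨hx, rfl⟩
    exact ⟨g, x, rfl, hx, rfl⟩

theorem isTransformation_rightTranslation (h : IsProjectionSystem mul meet χ) (a : G) :
    IsTransformation (rightTranslation mul meet χ a) := by
  rintro _ b c ⟨g, x, rfl, hx, rfl⟩ hc
  exact (h.mem_rightTranslation.1 hc).2.symm

theorem coact_mul (h : IsProjectionSystem mul meet χ) (x : Option G) (a b : G) :
    coact mul x (mul a b) = mul (coact mul x a) b := by
  cases x <;> simp [coact, h.assoc]

theorem coact_meet (h : IsProjectionSystem mul meet χ) (x : Option G) (a b : G) :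
    coact mul x (meet a b) = meet (coact mul x a) (coact mul x b) := by
  cases x <;> simp [coact, h.mul_meet]

theorem rightTranslation_mul (h : IsProjectionSystem mul meet χ) (a b : G) :
    rightTranslation mul meet χ (mul a b) =
      comp (rightTranslation mul meet χ b) (rightTranslation mul meet χ a) := by
  ext ⟨p, q⟩
  constructor
  · rintro ⟨g, x, rfl, hx, rfl⟩
    rw [h.coact_mul] at hx ⊢
    exact ⟨_, h.mem_rightTranslation.2 ⟨h.right_negative _ _ _ hx, rfl⟩,
      h.mem_rightTranslation.2 ⟨hx, rfl⟩⟩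
  · rintro ⟨_, ⟨g, x, rfl, hx, rfl⟩, hb⟩
    obtain ⟨hxb, hq⟩ := h.mem_rightTranslation.1 hb
    refine h.mem_rightTranslation.2 ?_
    rw [h.coact_mul]
    exact ⟨hxb, hq⟩

theorem rightTranslation_meet (h : IsProjectionSystem mul meet χ) (a b : G) :
    rightTranslation mul meet χ (meet a b) =
      rightTranslation mul meet χ a ∩ rightTranslation mul meet χ b := by
  have key : ∀ {g y z : G}, χ g (meet y z) →
      agreeClass meet χ g (some (meet y z)) = agreeClass meet χ g (some y) := by
    intro g y z hg
    refine (h.agreeClass_eq_iff ?_).2 ?_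
    · simpa only [AgreeAt, h.idem] using hg
    · simpa only [AgreeAt, h.comm _ y, ← h.meet_assoc, h.idem] using hg
  ext ⟨p, q⟩
  constructor
  · rintro ⟨g, x, rfl, hx, rfl⟩
    rw [h.coact_meet] at hx ⊢
    refine ⟨h.mem_rightTranslation.2 ⟨h.meet_left hx, ?_⟩,
      h.mem_rightTranslation.2 ⟨h.meet_right hx, ?_⟩⟩
    · rw [key hx]
    · rw [h.comm] at hx ⊢
      rw [key hx]
  · rintro ⟨⟨g, x, rfl, hx, rfl⟩, hb⟩
    obtain ⟨hb, e⟩ := h.mem_rightTranslation.1 hb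
    have hm : χ g (meet (coact mul x a) (coact mul x b)) :=
      (h.agreeClass_eq_iff (by simpa only [AgreeAt, h.idem] using hx)).1 (congrArg Prod.snd e)
    refine h.mem_rightTranslation.2 ?_
    rw [h.coact_meet, key hm]
    exact ⟨hm, rfl⟩

theorem pr1_rightTranslation_subset_iff (h : IsProjectionSystem mul meet χ) (a b : G) :
    pr1 (rightTranslation mul meet χ a) ⊆ pr1 (rightTranslation mul meet χ b) ↔ χ a b := by
  constructor
  · intro hs
    have ha : χ a (coact mul none a) := h.refl a
    obtain ⟨q, hq⟩ := hs ⟨_, h.mem_rightTranslation.2 ⟨ha, rfl⟩⟩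
    exact (h.mem_rightTranslation.1 hq).1
  · rintro hab _ ⟨_, g, x, rfl, hx, rfl⟩
    refine ⟨_, h.mem_rightTranslation.2 ⟨h.trans _ _ _ hx ?_, rfl⟩⟩
    rcases x with _ | x
    · exact hab
    · exact h.left_regular _ _ _ hab

theorem rightTranslation_injective (h : IsProjectionSystem mul meet χ) :
    Function.Injective (rightTranslation mul meet χ) := by
  have key : ∀ {a b}, rightTranslation mul meet χ a = rightTranslation mul meet χ b →
      meet a b = a := by
    intro a b e
    apply h.le_of_meet
    rw [← h.pr1_rightTranslation_subset_iff, h.rightTranslation_meet, ← e, Set.inter_self]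
  intro a b e
  rw [← key e, h.comm, key e.symm]

end IsProjectionSystem

section Transformations

variable {A : Type*} {f f' g g' k : Set (A × A)}

theorem pr1_comp_subset : pr1 (comp g f) ⊆ pr1 f := by
  rintro a ⟨c, b, hb, -⟩
  exact ⟨b, hb⟩

theorem pr1_mono (h : f ⊆ g) : pr1 f ⊆ pr1 g := fun _ ⟨b, hb⟩ => ⟨b, h hb⟩

theorem comp_mono_right (h : f ⊆ f') : comp g f ⊆ comp g f' :=
  fun _ ⟨b, hb, hc⟩ => ⟨b, h hb, hc⟩

theorem pr1_comp_mono (h : pr1 g ⊆ pr1 g') : pr1 (comp g f) ⊆ pr1 (comp g' f) := by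
  rintro a ⟨c, b, hb, hc⟩
  obtain ⟨d, hd⟩ := h ⟨c, hc⟩
  exact ⟨d, b, hb, hd⟩

theorem IsTransformation.inter_comp (hf : IsTransformation f) :
    comp (g ∩ g') f = comp g f ∩ comp g' f := by
  ext ⟨a, c⟩
  constructor
  · rintro ⟨b, hb, hc, hc'⟩
    exact ⟨⟨b, hb, hc⟩, ⟨b, hb, hc'⟩⟩
  · rintro ⟨⟨b, hb, hc⟩, ⟨b', hb', hc'⟩⟩
    obtain rfl := hf hb hb'
    exact ⟨b, hb, hc, hc'⟩

theorem IsTransformation.subset_of_pr1_subset_inter (hf : IsTransformation f)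
    (h : pr1 f ⊆ pr1 (f ∩ g)) : f ⊆ g := by
  rintro ⟨a, b⟩ hb
  obtain ⟨c, hc, hc'⟩ := h ⟨b, hb⟩
  obtain rfl := hf hb hc
  exact hc'

theorem IsTransformation.mem_inter_inter (hg : IsTransformation g) {a b c : A}
    (h₁ : (a, b) ∈ f ∩ g) (h₂ : (a, c) ∈ g ∩ k) : (a, c) ∈ f ∩ g ∩ k := by
  obtain rfl := hg h₁.2 h₂.1
  exact ⟨h₁, h₂.2⟩

end Transformations

/-- Abstract characterization of projection ∩-semigroups (Φ,∘,∩,χ_Φ) of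
transformations.  Here x ⊏ y stands for χ x y and x ≤ y for meet x y = x. -/
theorem statement_4 {G : Type u} (mul meet : G → G → G) (χ : G → G → Prop)
    (hassoc : ∀ a b c, mul (mul a b) c = mul a (mul b c))
    (hcomm : ∀ a b, meet a b = meet b a)
    (hmassoc : ∀ a b c, meet (meet a b) c = meet a (meet b c))
    (hidem : ∀ a, meet a a = a) :
    (∃ (A : Type u) (_ : Nonempty A) (Φ : Set (Set (A × A))),
      (∀ f ∈ Φ, IsTransformation f) ∧
      (∀ f ∈ Φ, ∀ g ∈ Φ, comp g f ∈ Φ) ∧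
      (∀ f ∈ Φ, ∀ g ∈ Φ, f ∩ g ∈ Φ) ∧
      ∃ P : G → Set (A × A),
        (∀ g, P g ∈ Φ) ∧ Function.Injective P ∧ (∀ f ∈ Φ, ∃ g, P g = f) ∧
        (∀ a b, P (mul a b) = comp (P b) (P a)) ∧
        (∀ a b, P (meet a b) = P a ∩ P b) ∧
        (∀ a b, χ a b ↔ pr1 (P a) ⊆ pr1 (P b))) ↔
    ((∀ a, χ a a) ∧
     (∀ a b c, χ a b → χ b c → χ a c) ∧
     (∀ x a b, χ a b → χ (mul x a) (mul x b)) ∧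
     (∀ x y z, χ x (mul y z) → χ x y) ∧
     (∀ a b, meet a b = a → χ a b) ∧
     (∀ x y z, mul x (meet y z) = meet (mul x y) (mul x z)) ∧
     (∀ x y, χ x (meet x y) → meet x y = x) ∧
     (∀ (x y : G) (v : Option G), meet (act mul (meet x y) v) (act mul y v) =
       act mul (meet x y) v) ∧
     (∀ (x y z v : G) (w : Option G), χ x (meet y z) → χ x (act mul (meet z v) w) →
       χ x (act mul (meet (meet y z) v) w))) := by
  constructor
  · rintro ⟨A, -, Φ, hΦ, -, -, P, hP, hinj, -, hmul, hmeet, hχ⟩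
    have ht : ∀ g, IsTransformation (P g) := fun g => hΦ _ (hP g)
    have hle : ∀ a b, meet a b = a ↔ P a ⊆ P b := fun a b => by
      rw [← hinj.eq_iff, hmeet, Set.inter_eq_left]
    simp only [hχ]
    refine ⟨fun _ => subset_rfl, fun _ _ _ => Set.Subset.trans, fun x a b hab => ?_,
      fun x y z hx => ?_, fun a b hab => pr1_mono ((hle a b).1 hab), fun x y z => ?_,
      fun x y hx => ?_, fun x y v => ?_, fun x y z v w hyz hzv => ?_⟩
    · rw [hmul, hmul]
      exact pr1_comp_mono hab
    · rw [hmul] at hx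
      exact hx.trans pr1_comp_subset
    · apply hinj
      rw [hmul, hmeet, hmeet, hmul, hmul, (ht x).inter_comp]
    · rw [hmeet] at hx
      exact (hle x y).2 ((ht x).subset_of_pr1_subset_inter hx)
    · rw [hle]
      have hxy : P (meet x y) ⊆ P y := hmeet x y ▸ Set.inter_subset_right
      rcases v with _ | u
      · exact hxy
      · simp only [act, hmul]
        exact comp_mono_right hxy
    · intro a ha
      obtain ⟨b, hb⟩ := hyz ha
      obtain ⟨c, hc⟩ := hzv ha
      rw [hmeet] at hb
      rcases w with _ | u
      · simp only [act, hmeet] at hc ⊢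
        exact ⟨c, (ht z).mem_inter_inter hb hc⟩
      · simp only [act, hmul, hmeet] at hc ⊢
        obtain ⟨d, hd, hdc⟩ := hc
        exact ⟨c, d, (ht z).mem_inter_inter hb hd, hdc⟩
  · rintro ⟨h₁, h₂, h₃, h₄, h₅, h₆, h₇, h₈, h₉⟩
    have h : IsProjectionSystem mul meet χ :=
      ⟨hassoc, hcomm, hmassoc, hidem, h₁, h₂, h₃, h₄, h₅, h₆, h₇, h₈, h₉⟩
    refine ⟨Option G × Set (Option G), ⟨(none, ∅)⟩, Set.range (rightTranslation mul meet χ),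
      ?_, ?_, ?_, rightTranslation mul meet χ, Set.mem_range_self,
      h.rightTranslation_injective, fun _ hf => hf, h.rightTranslation_mul,
      h.rightTranslation_meet, fun a b => (h.pr1_rightTranslation_subset_iff a b).symm⟩
    · rintro _ ⟨a, rfl⟩
      exact h.isTransformation_rightTranslation a
    · rintro _ ⟨a, rfl⟩ _ ⟨b, rfl⟩
      exact ⟨mul a b, h.rightTranslation_mul a b⟩
    · rintro _ ⟨a, rfl⟩ _ ⟨b, rfl⟩
      exact ⟨meet a b, h.rightTranslation_meet a b⟩
end
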